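/- arXiv:math/9912035 — 10 statements merged into one kernel-verified Lean document; each statement's English description precedes it below -/
import Mathlib

section
/- For every integer i ≥ 4 there exists a unique integer j ≥ 1 such that c_{j−1} ≤ i < c_j; moreover this j satisfies j < i (so the recursive definition of the sequence a is well-defined). -/
/-- Convexity and strict growth of `a` at `k`, `k + 1`, `k + 2` make `c` increase there. -/
lemma threshold_lt_succ {a c : ℕ → ℕ} {k : ℕ}
    (hc : c k + (k + 1) * a k = (k + 2) * a (k + 1))
    (hc' : c (k + 1) + (k + 2) * a (k + 1) = (k + 3) * a (k + 2))
    (hlt : a k < a (k + 1)) (hconv : 2 * a (k + 1) ≤ a k + a (k + 2)) :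
    c k < c (k + 1) := by
  obtain ⟨d, hd⟩ := Nat.exists_eq_add_of_lt hlt
  obtain ⟨e, he⟩ : ∃ e, a (k + 2) = a (k + 1) + d + 1 + e :=
    ⟨a (k + 2) - (a (k + 1) + d + 1), by omega⟩
  rw [he, hd] at hc'
  rw [hd] at hc
  nlinarith [Nat.zero_le (k * e)]

/-- On the block of index `j` the sequence `a` has constant increment `j + 1`, also across the
right end of the block. -/
lemma succ_eq_add_of_mem_block {a c : ℕ → ℕ}
    (hc : ∀ j : ℕ, 1 ≤ j → c j + (j + 1) * a j = (j + 2) * a (j + 1))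
    (ha : ∀ i : ℕ, 4 ≤ i → ∀ j : ℕ, 1 ≤ j → c (j - 1) ≤ i → i < c j →
      a i + (j + 1) * a j = (j + 1) * i)
    {i j : ℕ} (hi : 4 ≤ i) (hj : 1 ≤ j) (hl : c (j - 1) ≤ i) (hu : i < c j)
    (hnext : i + 1 = c j → c j < c (j + 1)) : a (i + 1) = a i + (j + 1) := by
  have h₁ := ha i hi j hj hl hu
  rcases Nat.lt_or_ge (i + 1) (c j) with h | h
  · have h₂ := ha (i + 1) (by omega) j hj (by omega) h
    nlinarith
  · have he : i + 1 = c j := by omega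
    have h₂ := ha (i + 1) (by omega) (j + 1) (by omega) (by simpa using he.ge)
      (he ▸ hnext he)
    have h₃ := hc j hj
    rw [← he] at h₃
    nlinarith

lemma convex_and_exists_block {a c : ℕ → ℕ}
    (ha1 : a 1 = 1) (ha2 : a 2 = 2) (ha3 : a 3 = 4) (hc0 : c 0 = 2)
    (hc : ∀ j : ℕ, 1 ≤ j → c j + (j + 1) * a j = (j + 2) * a (j + 1))
    (ha : ∀ i : ℕ, 4 ≤ i → ∀ j : ℕ, 1 ≤ j → c (j - 1) ≤ i → i < c j →
      a i + (j + 1) * a j = (j + 1) * i) (n : ℕ) (hn : 3 ≤ n) :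
    (∀ k, 1 ≤ k → k < n → a k < a (k + 1) ∧ 2 * a (k + 1) ≤ a k + a (k + 2)) ∧
      ∃ j, 1 ≤ j ∧ j < n ∧ c (j - 1) ≤ n ∧ n < c j ∧ a (n + 1) = a n + (j + 1) := by
  have hc1 : c 1 = 4 := by have := hc 1 le_rfl; norm_num [ha1, ha2] at this; omega
  have hc2 : c 2 = 10 := by have := hc 2 (by omega); norm_num [ha2, ha3] at this; omega
  induction n, hn using Nat.le_induction with
  | base =>
    have ha4 : a 4 = 6 := by
      have := ha 4 le_rfl 2 (by omega) (by simp [hc1]) (by omega)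
      omega
    refine ⟨fun k hk hk' => ?_, 1, by simp [*]⟩
    interval_cases k <;> simp [*]
  | succ n hn ih =>
    obtain ⟨hB, j, hj, hjn, hl, hu, hstep⟩ := ih
    have hmono : ∀ k, k < n → c k < c (k + 1) := fun k hk => by
      rcases Nat.eq_zero_or_pos k with rfl | hk'
      · simp [hc0, hc1]
      · exact threshold_lt_succ (hc k hk') (hc (k + 1) (by omega)) (hB k hk' hk).1 (hB k hk' hk).2
    have hlow : ∀ k, 1 ≤ k → k ≤ n → k + 3 ≤ c k := fun k hk => by
      induction k, hk using Nat.le_induction with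
      | base => simp [hc1]
      | succ k hk ih => intro h; have := ih (by omega); have := hmono k (by omega); omega
    obtain ⟨j', hj', hjn', hl', hu', hjj⟩ : ∃ j', 1 ≤ j' ∧ j' < n + 1 ∧ c (j' - 1) ≤ n + 1 ∧
        n + 1 < c j' ∧ j ≤ j' := by
      rcases Nat.lt_or_ge (n + 1) (c j) with h | h
      · exact ⟨j, hj, by omega, by omega, h, le_rfl⟩
      · have := hmono j hjn
        exact ⟨j + 1, by omega, by omega, by simp; omega, by omega, by omega⟩
    have hnew : a (n + 1 + 1) = a (n + 1) + (j' + 1) :=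
      succ_eq_add_of_mem_block hc ha (by omega) hj' hl' hu' fun he => by
        have := hlow j' hj' (by omega)
        exact hmono j' (by omega)
    refine ⟨fun k hk hkn => ?_, j', hj', hjn', hl', hu', hnew⟩
    rcases Nat.lt_or_ge k n with h | h
    · exact hB k hk h
    · obtain rfl : k = n := by omega
      have : a (k + 2) = a (k + 1) + (j' + 1) := hnew
      omega

theorem stmt0 (a c : ℕ → ℕ)
    (ha1 : a 1 = 1) (ha2 : a 2 = 2) (ha3 : a 3 = 4)
    (hc0 : c 0 = 2)
    (hc : ∀ j : ℕ, 1 ≤ j → c j + (j + 1) * a j = (j + 2) * a (j + 1))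
    (ha : ∀ i : ℕ, 4 ≤ i → ∀ j : ℕ, 1 ≤ j → c (j - 1) ≤ i → i < c j →
      a i + (j + 1) * a j = (j + 1) * i) :
    ∀ i : ℕ, 4 ≤ i →
      (∃! j : ℕ, 1 ≤ j ∧ c (j - 1) ≤ i ∧ i < c j) ∧
      (∀ j : ℕ, 1 ≤ j → c (j - 1) ≤ i → i < c j → j < i) := by
  have key := convex_and_exists_block ha1 ha2 ha3 hc0 hc ha
  have hmono : StrictMono c := strictMono_nat_of_lt_succ fun k => by
    rcases Nat.eq_zero_or_pos k with rfl | hk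
    · have := hc 1 le_rfl
      norm_num [ha1, ha2] at this
      simp only [zero_add]
      omega
    · obtain ⟨h₁, h₂⟩ := (key (k + 3) (by omega)).1 k hk (by omega)
      exact threshold_lt_succ (hc k hk) (hc (k + 1) (by omega)) h₁ h₂
  intro i hi
  obtain ⟨-, j, hj, hji, hl, hu, -⟩ := key i (by omega)
  have huniq : ∀ k, 1 ≤ k ∧ c (k - 1) ≤ i ∧ i < c k → k = j := by
    rintro k ⟨hk, hkl, hku⟩
    have h₁ := hmono.lt_iff_lt.1 (hkl.trans_lt hu)
    have h₂ := hmono.lt_iff_lt.1 (hl.trans_lt hku)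
    omega
  exact ⟨⟨j, ⟨hj, hl, hu⟩, huniq⟩, fun k hk hkl hku => huniq k ⟨hk, hkl, hku⟩ ▸ hji⟩
end

section
/- The sequence a is strictly increasing: a_{i+1} > a_i for every integer i ≥ 1. -/
/-- Where `a` is increasing and convex up to `n`, consecutive values of `c` differ by at least
two. -/
theorem add_two_le_breakpoint (a c : ℕ → ℕ) (hc01 : c 0 + 2 ≤ c 1)
    (hc : ∀ j : ℕ, 1 ≤ j → c j + (j + 1) * a j = (j + 2) * a (j + 1)) (n : ℕ)
    (hlt : ∀ m, 1 ≤ m → m ≤ n → a m < a (m + 1))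
    (hconv : ∀ m, 1 ≤ m → m < n → 2 * a (m + 1) ≤ a m + a (m + 2)) (m : ℕ) (hm : m < n) :
    c m + 2 ≤ c (m + 1) := by
  rcases Nat.eq_zero_or_pos m with rfl | hpos
  · exact hc01
  · have h1 := hc m hpos
    have h2 := hc (m + 1) (by omega)
    have h3 := hlt (m + 1) (by omega) (by omega)
    have h4 := hconv m hpos hm
    have h5 : (m + 1) * (2 * a (m + 1)) ≤ (m + 1) * (a m + a (m + 2)) :=
      Nat.mul_le_mul_left _ h4
    simp only [Nat.add_assoc, Nat.reduceAdd] at *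
    nlinarith

/-- The increment of `a` at `n` is `k + 2`, where `c k ≤ n < c (k + 1)`; in particular `a` is
increasing and convex. -/
theorem increment_eq_and_convex (a c : ℕ → ℕ)
    (ha1 : a 1 = 1) (ha2 : a 2 = 2) (ha3 : a 3 = 4)
    (hc0 : c 0 = 2)
    (hc : ∀ j : ℕ, 1 ≤ j → c j + (j + 1) * a j = (j + 2) * a (j + 1))
    (ha : ∀ i : ℕ, 4 ≤ i → ∀ j : ℕ, 1 ≤ j → c (j - 1) ≤ i → i < c j →
      a i + (j + 1) * a j = (j + 1) * i) (n : ℕ) (hn : 4 ≤ n) :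
    (∀ m, 1 ≤ m → m ≤ n → a m < a (m + 1)) ∧
    (∀ m, 1 ≤ m → m < n → 2 * a (m + 1) ≤ a m + a (m + 2)) ∧
    ∃ k, k + 2 ≤ n ∧ c k ≤ n ∧ n < c (k + 1) ∧ a (n + 1) = a n + (k + 2) := by
  have hc1 : c 1 = 4 := by have := hc 1 le_rfl; simp [ha1, ha2] at this; omega
  have hc2 : c 2 = 10 := by have := hc 2 (by omega); simp [ha2, ha3] at this; omega
  have hblock : ∀ i k, 4 ≤ i → c k ≤ i → i < c (k + 1) →
      a i + (k + 2) * a (k + 1) = (k + 2) * i := fun i k hi h1 h2 =>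
    ha i hi (k + 1) (by omega) h1 h2
  induction n, hn using Nat.le_induction with
  | base =>
    have h4 : a 4 = 6 := by
      have := hblock 4 1 (by omega) (by omega) (by simp [hc2]); simp [ha2] at this; omega
    have h5 : a 5 = 9 := by
      have := hblock 5 1 (by omega) (by omega) (by simp [hc2]); simp [ha2] at this; omega
    refine ⟨?_, ?_, 1, by omega, by omega, by simp [hc2], by simp [h4, h5]⟩
    · intro m h1 h2
      interval_cases m <;> simp [*]
    · intro m h1 h2
      interval_cases m <;> simp [*]
  | succ n hn ih =>
    obtain ⟨hlt, hconv, k, hkn, hk1, hk2, hinc⟩ := ih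
    have hgap := add_two_le_breakpoint a c (by omega) hc n hlt hconv
    have hg := hgap (k + 1) (by omega)
    have hck := hc (k + 1) (by omega)
    simp only [Nat.add_assoc, Nat.reduceAdd] at hg hck
    have key : ∃ k', k ≤ k' ∧ k' + 2 ≤ n + 1 ∧ c k' ≤ n + 1 ∧ n + 1 < c (k' + 1) ∧
        a (n + 2) = a (n + 1) + (k' + 2) := by
      by_cases h : n + 1 < c (k + 1)
      · refine ⟨k, le_rfl, by omega, by omega, h, ?_⟩
        have e1 := hblock (n + 1) k (by omega) (by omega) h
        by_cases h' : n + 2 < c (k + 1)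
        · have e2 := hblock (n + 2) k (by omega) (by omega) h'
          nlinarith
        · have heq : c (k + 1) = n + 2 := by omega
          have e2 := hblock (n + 2) (k + 1) (by omega) (by omega)
            (by simp only [Nat.add_assoc, Nat.reduceAdd]; omega)
          simp only [Nat.add_assoc, Nat.reduceAdd] at e2
          rw [heq] at hck
          nlinarith
      · have hn2 : n + 2 < c (k + 1 + 1) := by
          simp only [Nat.add_assoc, Nat.reduceAdd]; omega
        refine ⟨k + 1, by omega, by omega, by omega, by omega, ?_⟩
        have e1 := hblock (n + 1) (k + 1) (by omega) (by omega) (by omega)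
        have e2 := hblock (n + 2) (k + 1) (by omega) (by omega) hn2
        nlinarith
    obtain ⟨k', hkk, h1, h2, h3, h4⟩ := key
    refine ⟨?_, ?_, k', h1, h2, h3, h4⟩
    · intro m hm hmn
      rcases Nat.lt_or_ge n m with h | h
      · obtain rfl : m = n + 1 := by omega
        simp only [Nat.add_assoc, Nat.reduceAdd]; omega
      · exact hlt m hm h
    · intro m hm hmn
      rcases Nat.lt_or_ge m n with h | h
      · exact hconv m hm h
      · obtain rfl : m = n := by omega
        omega

theorem stmt1 (a c : ℕ → ℕ)
    (ha1 : a 1 = 1) (ha2 : a 2 = 2) (ha3 : a 3 = 4)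
    (hc0 : c 0 = 2)
    (hc : ∀ j : ℕ, 1 ≤ j → c j + (j + 1) * a j = (j + 2) * a (j + 1))
    (ha : ∀ i : ℕ, 4 ≤ i → ∀ j : ℕ, 1 ≤ j → c (j - 1) ≤ i → i < c j →
      a i + (j + 1) * a j = (j + 1) * i) :
    ∀ i : ℕ, 1 ≤ i → a i < a (i + 1) := fun i hi =>
  (increment_eq_and_convex a c ha1 ha2 ha3 hc0 hc ha (i + 4) (by omega)).1 i hi (by omega)
end

section
/- The sequence c is strictly increasing; more precisely, for every integer i ≥ 1 one has c_i − c_{i−1} ≥ 2(a_{i+1} − a_i) > 0. -/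
/-- An index `n ≥ 1` below which `c` is strictly increasing satisfies `n + 3 ≤ c n`. -/
lemma add_three_le_of_lt_succ {c : ℕ → ℕ} (hc1 : c 1 = 4) {n : ℕ}
    (hlt : ∀ k < n, c k < c (k + 1)) (m : ℕ) (hm : 1 ≤ m) (hmn : m ≤ n) : m + 3 ≤ c m := by
  induction m, hm using Nat.le_induction with
  | base => omega
  | succ k hk ih =>
    have := hlt k (by omega)
    have := ih (by omega)
    omega

lemma exists_index_between {c : ℕ → ℕ} (hc0 : c 0 = 2) {n i : ℕ} (hi : 2 ≤ i) (hin : i < c n) :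
    ∃ j, j + 1 ≤ n ∧ c j ≤ i ∧ i < c (j + 1) := by
  classical
  have hex : ∃ j, i < c j := ⟨n, hin⟩
  have hspec := Nat.find_spec hex
  have hle : Nat.find hex ≤ n := Nat.find_min' hex hin
  obtain ⟨j, hj⟩ : ∃ j, Nat.find hex = j + 1 := by
    refine Nat.exists_eq_succ_of_ne_zero fun h => ?_
    rw [h] at hspec
    omega
  have hmin := Nat.find_min hex (m := j) (by omega)
  rw [hj] at hspec hle
  exact ⟨j, hle, by omega, hspec⟩

section Recursion

variable {a c : ℕ → ℕ}

lemma rec_of_two_le (ha1 : a 1 = 1) (ha2 : a 2 = 2) (ha3 : a 3 = 4) (hc1 : c 1 = 4)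
    (ha : ∀ i : ℕ, 4 ≤ i → ∀ j : ℕ, 1 ≤ j → c (j - 1) ≤ i → i < c j →
      a i + (j + 1) * a j = (j + 1) * i)
    {n : ℕ} (hlt : ∀ k < n, c k < c (k + 1)) {i j : ℕ} (hi : 2 ≤ i) (hjn : j + 1 ≤ n)
    (hji : c j ≤ i) (hij : i < c (j + 1)) :
    a i + (j + 2) * a (j + 1) = (j + 2) * i := by
  by_cases h4 : 4 ≤ i
  · exact ha i h4 (j + 1) (by omega) hji hij
  · have hj : j = 0 := by
      by_contra h
      have := add_three_le_of_lt_succ hc1 hlt j (by omega) (by omega)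
      omega
    subst hj
    obtain rfl | rfl : i = 2 ∨ i = 3 := by omega
    · simp [ha1, ha2]
    · simp [ha1, ha3]

/-- On the block `[c j, c (j + 1))` the sequence `a` has constant slope `j + 2`. -/
lemma succ_eq_add_slope (ha1 : a 1 = 1) (ha2 : a 2 = 2) (ha3 : a 3 = 4) (hc1 : c 1 = 4)
    (hc : ∀ j : ℕ, 1 ≤ j → c j + (j + 1) * a j = (j + 2) * a (j + 1))
    (ha : ∀ i : ℕ, 4 ≤ i → ∀ j : ℕ, 1 ≤ j → c (j - 1) ≤ i → i < c j →
      a i + (j + 1) * a j = (j + 1) * i)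
    {n : ℕ} (hlt : ∀ k < n, c k < c (k + 1)) {i j : ℕ} (hi : 2 ≤ i) (hin : i + 1 < c n)
    (hjn : j + 1 ≤ n) (hji : c j ≤ i) (hij : i < c (j + 1)) :
    a (i + 1) = a i + (j + 2) := by
  have h1 := rec_of_two_le ha1 ha2 ha3 hc1 ha hlt hi hjn hji hij
  by_cases hb : i + 1 < c (j + 1)
  · have h2 := rec_of_two_le ha1 ha2 ha3 hc1 ha hlt (by omega) hjn (by omega : c j ≤ i + 1) hb
    linarith
  · have hb' : c (j + 1) = i + 1 := by omega
    have hne : j + 1 ≠ n := by rintro rfl; omega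
    have h3 := hlt (j + 1) (by omega)
    have h2 := rec_of_two_le ha1 ha2 ha3 hc1 ha hlt (by omega) (by omega : j + 1 + 1 ≤ n)
      hb'.le (by omega)
    have h4 := hc (j + 1) (by omega)
    rw [hb'] at h4
    linarith

lemma slope_pos_and_le (ha1 : a 1 = 1) (ha2 : a 2 = 2) (ha3 : a 3 = 4)
    (hc0 : c 0 = 2) (hc1 : c 1 = 4)
    (hc : ∀ j : ℕ, 1 ≤ j → c j + (j + 1) * a j = (j + 2) * a (j + 1))
    (ha : ∀ i : ℕ, 4 ≤ i → ∀ j : ℕ, 1 ≤ j → c (j - 1) ≤ i → i < c j →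
      a i + (j + 1) * a j = (j + 1) * i)
    {n : ℕ} (hlt : ∀ k < n, c k < c (k + 1)) {i : ℕ} (hi : 2 ≤ i) (hin : i + 2 < c n) :
    a (i + 1) < a (i + 2) ∧ a (i + 1) + a (i + 1) ≤ a (i + 2) + a i := by
  obtain ⟨j, hjn, hji, hij⟩ := exists_index_between hc0 hi (by omega : i < c n)
  have h1 := succ_eq_add_slope ha1 ha2 ha3 hc1 hc ha hlt hi (by omega) hjn hji hij
  by_cases hb : i + 1 < c (j + 1)
  · have h2 := succ_eq_add_slope ha1 ha2 ha3 hc1 hc ha hlt (i := i + 1) (by omega) hin hjn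
      (by omega) hb
    rw [show i + 1 + 1 = i + 2 from rfl] at h2
    omega
  · have hne : j + 1 ≠ n := by rintro rfl; omega
    have h3 := hlt (j + 1) (by omega)
    have h2 := succ_eq_add_slope ha1 ha2 ha3 hc1 hc ha hlt (i := i + 1) (j := j + 1) (by omega) hin
      (by omega) (by omega) (by omega)
    rw [show i + 1 + 1 = i + 2 from rfl] at h2
    omega

end Recursion

theorem stmt2 (a c : ℕ → ℕ)
    (ha1 : a 1 = 1) (ha2 : a 2 = 2) (ha3 : a 3 = 4)
    (hc0 : c 0 = 2)
    (hc : ∀ j : ℕ, 1 ≤ j → c j + (j + 1) * a j = (j + 2) * a (j + 1))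
    (ha : ∀ i : ℕ, 4 ≤ i → ∀ j : ℕ, 1 ≤ j → c (j - 1) ≤ i → i < c j →
      a i + (j + 1) * a j = (j + 1) * i) :
    ∀ i : ℕ, 1 ≤ i →
      2 * ((a (i + 1) : ℤ) - a i) ≤ (c i : ℤ) - c (i - 1) ∧
      0 < 2 * ((a (i + 1) : ℤ) - a i) := by
  have hc1 : c 1 = 4 := by
    have := hc 1 le_rfl
    norm_num [ha1, ha2] at this
    omega
  have hc2 : c 2 = 10 := by
    have := hc 2 (by omega)
    norm_num [ha2, ha3] at this
    omega
  intro i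
  induction i using Nat.strong_induction_on with
  | _ i ih =>
    intro hi
    obtain rfl | rfl | hi3 : i = 1 ∨ i = 2 ∨ 3 ≤ i := by omega
    · norm_num [ha1, ha2, hc0, hc1]
    · norm_num [ha2, ha3, hc1, hc2]
    · obtain ⟨m, rfl⟩ : ∃ m, i = m + 1 := ⟨i - 1, by omega⟩
      have hlt : ∀ k < m, c k < c (k + 1) := by
        intro k hk
        have := ih (k + 1) (by omega) (by omega)
        rw [Nat.add_sub_cancel] at this
        omega
      have hm := add_three_le_of_lt_succ hc1 hlt m (by omega) le_rfl
      obtain ⟨hpos, hconv⟩ := slope_pos_and_le ha1 ha2 ha3 hc0 hc1 hc ha hlt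
        (i := m) (by omega) (by omega)
      have e1 := hc (m + 1) (by omega)
      have e2 := hc m (by omega)
      rw [Nat.add_sub_cancel]
      rw [show m + 1 + 1 = m + 2 from rfl] at *
      zify at hpos hconv e1 e2
      refine ⟨?_, by linarith⟩
      have := mul_nonneg (by positivity : (0 : ℤ) ≤ m + 1) (sub_nonneg.2 hconv)
      linarith
end

section
/- For every integer i ≥ 4, the increment of the sequence a satisfies a_{i+1} − a_i = b_i + 1, where b_i is the unique j with c_{j−1} ≤ i < c_j. (In particular, if i+1 < c_{b_i} then a_{i+1} = (b_i+1)(i+1−a_{b_i}), and if i+1 = c_{b_i} then a_{i+1} = (b_i+2)(i+1−a_{b_i+1}), and in both cases the increment equals b_i + 1.) -/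
/-- The increment of `a` inside the block `[c (m - 1), c m)` and at its right end is `m + 1`,
provided that the next block is nonempty in the latter case. -/
theorem increment_of_mem_block {a c : ℕ → ℕ}
    (hc : ∀ j : ℕ, 1 ≤ j → c j + (j + 1) * a j = (j + 2) * a (j + 1))
    (ha : ∀ i : ℕ, 4 ≤ i → ∀ j : ℕ, 1 ≤ j → c (j - 1) ≤ i → i < c j →
      a i + (j + 1) * a j = (j + 1) * i)
    {i m : ℕ} (hi : 4 ≤ i) (hm : 1 ≤ m) (hl : c (m - 1) ≤ i) (hr : i < c m)
    (hlt : i + 1 = c m → c m < c (m + 1)) : a (i + 1) = a i + m + 1 := by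
  have h := ha i hi m hm hl hr
  rcases Nat.lt_or_ge (i + 1) (c m) with h1 | h1
  · have h2 := ha (i + 1) (by omega) m hm (by omega) h1
    linarith
  · have he : i + 1 = c m := by omega
    have h2 := ha (i + 1) (by omega) (m + 1) (by omega) he.ge (he ▸ hlt he)
    have h3 := hc m hm
    rw [← he] at h3
    linarith

/-- If a sequence starts at or below `i` and exceeds `i` at `j`, then it first exceeds `i`
at some index between `1` and `j`. -/
theorem exists_block {c : ℕ → ℕ} {i j : ℕ} (h0 : c 0 ≤ i) (hj : i < c j) :
    ∃ m, 1 ≤ m ∧ m ≤ j ∧ c (m - 1) ≤ i ∧ i < c m := by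
  classical
  have hex : ∃ m, i < c m := ⟨j, hj⟩
  have hpos : Nat.find hex ≠ 0 := fun h => by
    have := Nat.find_spec hex
    rw [h] at this
    omega
  exact ⟨Nat.find hex, by omega, Nat.find_le hj,
    not_lt.mp (Nat.find_min hex (by omega)), Nat.find_spec hex⟩

theorem block_bounds_strictMono {a c : ℕ → ℕ}
    (ha1 : a 1 = 1) (ha2 : a 2 = 2) (ha3 : a 3 = 4) (hc0 : c 0 = 2)
    (hc : ∀ j : ℕ, 1 ≤ j → c j + (j + 1) * a j = (j + 2) * a (j + 1))
    (ha : ∀ i : ℕ, 4 ≤ i → ∀ j : ℕ, 1 ≤ j → c (j - 1) ≤ i → i < c j →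
      a i + (j + 1) * a j = (j + 1) * i) (j : ℕ) : c j < c (j + 1) := by
  have hc1 : c 1 = 4 := by have := hc 1 le_rfl; norm_num [ha1, ha2] at this; omega
  have hc2 : c 2 = 10 := by have := hc 2 (by omega); norm_num [ha2, ha3] at this; omega
  have ha4 : a 4 = 6 := by
    have := ha 4 le_rfl 2 (by omega) (by simp [hc1]) (by omega)
    norm_num [ha2] at this; omega
  have ha5 : a 5 = 9 := by
    have := ha 5 (by omega) 2 (by omega) (by simp [hc1]) (by omega)
    norm_num [ha2] at this; omega
  have hc3 : c 3 = 14 := by have := hc 3 (by omega); norm_num [ha3, ha4] at this; omega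
  have hc4 : c 4 = 24 := by have := hc 4 (by omega); norm_num [ha4, ha5] at this; omega
  induction j using Nat.strong_induction_on with
  | _ j ih =>
    obtain rfl | rfl | rfl | rfl | hj : j = 0 ∨ j = 1 ∨ j = 2 ∨ j = 3 ∨ 4 ≤ j := by omega
    · simp [hc0, hc1]
    · simp [hc1, hc2]
    · simp [hc2, hc3]
    · simp [hc3, hc4]
    have hgrow : ∀ k, 4 ≤ k → k ≤ j → k + 20 ≤ c k := by
      intro k hk
      induction k, hk using Nat.le_induction with
      | base => omega
      | succ k hk ihk =>
        intro hkj
        have := ihk (by omega)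
        have := ih k (by omega)
        omega
    have hcj := hgrow j hj le_rfl
    have hstep : ∀ i m, m ≤ j → i + 1 < c j → i + 1 = c m → c m < c (m + 1) := by
      intro i m hm hi he
      refine ih m (lt_of_le_of_ne hm ?_)
      rintro rfl
      omega
    obtain ⟨m, hm, hmj, hl, hr⟩ := exists_block (c := c) (i := j) (j := j) (by omega) (by omega)
    have hd := increment_of_mem_block hc ha hj hm hl hr (hstep j m hmj (by omega))
    have hd' : a (j + 1) + m + 1 ≤ a (j + 1 + 1) := by
      rcases Nat.lt_or_ge (j + 1) (c m) with h | h
      · have := increment_of_mem_block hc ha (i := j + 1) (by omega) hm (by omega) h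
          (hstep (j + 1) m hmj (by omega))
        exact this.ge
      · have he : j + 1 = c m := by omega
        have hlt := hstep j m hmj (by omega) he
        have hmj' : m + 1 ≤ j := by
          rcases hmj.lt_or_eq with h' | rfl <;> omega
        have := increment_of_mem_block hc ha (i := j + 1) (m := m + 1) (by omega) (by omega)
          h (by omega) (hstep (j + 1) (m + 1) hmj' (by omega))
        omega
    have h1 := hc j (by omega)
    have h2 := hc (j + 1) (by omega)
    have h3 := Nat.mul_le_mul_left (j + 3) hd'
    have h4 : (j + 1) * a (j + 1) = (j + 1) * (a j + m + 1) := by rw [hd]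
    nlinarith [Nat.zero_le m]


theorem stmt3 (a c : ℕ → ℕ)
    (ha1 : a 1 = 1) (ha2 : a 2 = 2) (ha3 : a 3 = 4)
    (hc0 : c 0 = 2)
    (hc : ∀ j : ℕ, 1 ≤ j → c j + (j + 1) * a j = (j + 2) * a (j + 1))
    (ha : ∀ i : ℕ, 4 ≤ i → ∀ j : ℕ, 1 ≤ j → c (j - 1) ≤ i → i < c j →
      a i + (j + 1) * a j = (j + 1) * i)
    (b : ℕ → ℕ)
    (hb1 : ∀ i : ℕ, 1 ≤ i → i ≤ 3 → b i = 1)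
    (hb : ∀ i : ℕ, 4 ≤ i → 1 ≤ b i ∧ c (b i - 1) ≤ i ∧ i < c (b i)) :
    ∀ i : ℕ, 4 ≤ i →
      (i + 1 < c (b i) → a (i + 1) + (b i + 1) * a (b i) = (b i + 1) * (i + 1)) ∧
      (i + 1 = c (b i) → a (i + 1) + (b i + 2) * a (b i + 1) = (b i + 2) * (i + 1)) ∧
      (a (i + 1) : ℤ) - a i = (b i : ℤ) + 1 := by
  intro i hi
  obtain ⟨hm, hl, hr⟩ := hb i hi
  have hlt := block_bounds_strictMono ha1 ha2 ha3 hc0 hc ha (b i)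
  refine ⟨fun h => ha (i + 1) (by omega) (b i) hm (by omega) h,
    fun h => ha (i + 1) (by omega) (b i + 1) (by omega) h.ge (h ▸ hlt), ?_⟩
  have := increment_of_mem_block hc ha hi hm hl hr fun _ => hlt
  omega
end

section
/- The sequence a is convex for i ≥ 4: for every integer i ≥ 4, (a_{i+1} − a_i) − (a_i − a_{i−1}) ≥ 0. -/
/-- For `j ≥ 1` the values `c (j - 1) < c j` are far enough ahead of `j`, and strictly before `c j`
the sequence `a` is increasing and convex, with increments at most `j + 1`. -/
theorem convex_below_breakpoint (a c : ℕ → ℕ)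
    (ha1 : a 1 = 1) (ha2 : a 2 = 2) (ha3 : a 3 = 4)
    (hc0 : c 0 = 2)
    (hc : ∀ j : ℕ, 1 ≤ j → c j + (j + 1) * a j = (j + 2) * a (j + 1))
    (ha : ∀ i : ℕ, 4 ≤ i → ∀ j : ℕ, 1 ≤ j → c (j - 1) ≤ i → i < c j →
      a i + (j + 1) * a j = (j + 1) * i) (j : ℕ) :
    j + 4 ≤ c (j + 1) ∧ c j < c (j + 1) ∧
      ∀ i : ℕ, 1 ≤ i → i + 2 < c (j + 1) →
        a i + 1 ≤ a (i + 1) ∧ 2 * a (i + 1) ≤ a (i + 2) + a i ∧ a (i + 2) ≤ a (i + 1) + j + 2 := by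
  have hc1 : c 1 = 4 := by
    have := hc 1 le_rfl
    norm_num [ha1, ha2] at this
    omega
  have block : ∀ i j : ℕ, 2 ≤ i → (4 ≤ i ∨ j = 0) → c j ≤ i → i < c (j + 1) →
      a i + (j + 2) * a (j + 1) = (j + 2) * i := by
    intro i j hi hij h1 h2
    by_cases h4 : 4 ≤ i
    · exact ha i h4 (j + 1) (by omega) h1 h2
    · obtain rfl : j = 0 := by omega
      obtain rfl | rfl : i = 2 ∨ i = 3 := by omega
      · norm_num [ha1, ha2]
      · norm_num [ha1, ha3]
  induction j with
  | zero =>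
    refine ⟨by norm_num [hc1], by norm_num [hc1, hc0], ?_⟩
    intro i hi hi'
    norm_num [hc1] at hi'
    obtain rfl : i = 1 := by omega
    norm_num [ha1, ha2, ha3]
  | succ j ih =>
    obtain ⟨hj, hlt, hconv⟩ := ih
    have hlt' : c (j + 1) < c (j + 2) := by
      obtain ⟨h1, h2, -⟩ := hconv (j + 1) (by omega) (by omega)
      have e1 := hc (j + 1) (by omega)
      have e2 := hc (j + 2) (by omega)
      simp only [Nat.add_assoc, Nat.reduceAdd] at h1 h2 e1 e2
      nlinarith
    rw [show j + 1 + 1 = j + 2 from rfl]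
    refine ⟨by omega, hlt', ?_⟩
    have hcj := hc (j + 1) (by omega)
    have inner : ∀ i, c (j + 1) ≤ i → i + 1 < c (j + 2) → a (i + 1) = a i + j + 3 := by
      intro i h1 h2
      have e1 := block i (j + 1) (by omega) (by omega) h1 (Nat.lt_of_succ_lt h2)
      have e2 := block (i + 1) (j + 1) (by omega) (by omega) (by omega) h2
      nlinarith
    have edge : ∀ i, i + 1 = c (j + 1) → a (i + 1) = a i + j + 2 := by
      intro i h1
      have e1 := block i j (by omega) (by omega) (by omega) (by omega)
      have e2 := block (i + 1) (j + 1) (by omega) (by omega) h1.ge (h1 ▸ hlt')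
      rw [← h1] at hcj
      simp only [Nat.add_assoc, Nat.reduceAdd] at hcj e1 e2 ⊢
      nlinarith
    intro i hi hi'
    rcases lt_trichotomy (i + 2) (c (j + 1)) with h | h | h
    · obtain ⟨h1, h2, h3⟩ := hconv i hi h
      exact ⟨h1, h2, by omega⟩
    · have e := edge (i + 1) h
      simp only [Nat.add_assoc, Nat.reduceAdd] at e
      obtain rfl | h2 : i = 1 ∨ 2 ≤ i := by omega
      · norm_num [ha1, ha2, ha3]
        omega
      · obtain ⟨k, rfl⟩ : ∃ k, i = k + 1 := ⟨i - 1, by omega⟩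
        obtain ⟨h1, h2, h3⟩ := hconv k (by omega) (by omega)
        simp only [Nat.add_assoc, Nat.reduceAdd] at *
        omega
    · have e := inner (i + 1) (by omega) hi'
      simp only [Nat.add_assoc, Nat.reduceAdd] at e
      by_cases h' : i + 1 = c (j + 1)
      · have := edge i h'
        omega
      · have := inner i (by omega) (by omega)
        omega

theorem stmt4 (a c : ℕ → ℕ)
    (ha1 : a 1 = 1) (ha2 : a 2 = 2) (ha3 : a 3 = 4)
    (hc0 : c 0 = 2)
    (hc : ∀ j : ℕ, 1 ≤ j → c j + (j + 1) * a j = (j + 2) * a (j + 1))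
    (ha : ∀ i : ℕ, 4 ≤ i → ∀ j : ℕ, 1 ≤ j → c (j - 1) ≤ i → i < c j →
      a i + (j + 1) * a j = (j + 1) * i) :
    ∀ i : ℕ, 4 ≤ i →
      0 ≤ ((a (i + 1) : ℤ) - a i) - ((a i : ℤ) - a (i - 1)) := by
  intro i hi
  obtain ⟨k, rfl⟩ : ∃ k, i = k + 1 := ⟨i - 1, by omega⟩
  obtain ⟨h1, -, h⟩ := convex_below_breakpoint a c ha1 ha2 ha3 hc0 hc ha k
  have := (h k (by omega) (by omega)).2.1
  simp only [Nat.add_assoc, Nat.reduceAdd, Nat.add_sub_cancel]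
  omega
end

section
/- Feasibility of the conjectured maximizer: for every n ≥ 1, the point α = (a_1, a_2, ..., a_n) lies in the polyhedron P_n; that is, for all integers 1 ≤ j ≤ i ≤ n one has (j+1)a_j + a_i ≥ (j+1)i + ε_{ij}, where ε_{ij} = 1 if i = j = 1 and ε_{ij} = 0 otherwise. Equivalently, a_i ≥ (p+1)(i − a_p) for every 1 ≤ p ≤ i (with the extra +1 when i = p = 1). -/
/-- If `c` increases strictly up to `J`, then for `2 ≤ i < c J` the value `a i` is the maximum over
`1 ≤ p ≤ J` of the affine functions `(p + 1) * (i - a p)`. -/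
theorem eq_max_of_increasing (a c : ℕ → ℕ)
    (ha1 : a 1 = 1) (ha2 : a 2 = 2) (ha3 : a 3 = 4)
    (hc0 : c 0 = 2)
    (hc : ∀ j : ℕ, 1 ≤ j → c j + (j + 1) * a j = (j + 2) * a (j + 1))
    (ha : ∀ i : ℕ, 4 ≤ i → ∀ j : ℕ, 1 ≤ j → c (j - 1) ≤ i → i < c j →
      a i + (j + 1) * a j = (j + 1) * i)
    (J : ℕ) (hJ : ∀ k < J, c k < c (k + 1)) (i : ℕ) (hi : 2 ≤ i) (hiJ : i < c J) :
    (∃ p, 1 ≤ p ∧ p ≤ J ∧ (a i : ℤ) = (p + 1) * (i - a p)) ∧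
      ∀ p, 1 ≤ p → p ≤ J → ((p : ℤ) + 1) * (i - a p) ≤ a i := by
  have hc1 : c 1 = 4 := by
    have := hc 1 le_rfl
    norm_num [ha1, ha2] at this
    omega
  have mono : ∀ m n, m ≤ n → n ≤ J → c m ≤ c n := by
    intro m n hmn
    induction n, hmn using Nat.le_induction with
    | base => intro _; exact le_rfl
    | succ n _ ih => intro hn; exact (ih (by omega)).trans (hJ n (by omega)).le
  have step : ∀ p : ℕ, 1 ≤ p → (((p + 1 : ℕ) : ℤ) + 1) * (i - a (p + 1)) =
      ((p : ℤ) + 1) * (i - a p) + (i - c p) := by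
    intro p hp
    have := hc p hp
    zify at this
    push_cast
    linarith
  obtain ⟨m, hm, hmin⟩ : ∃ m, i < c m ∧ ∀ k < m, c k ≤ i := by
    have h : ∃ m, i < c m := ⟨J, hiJ⟩
    exact ⟨Nat.find h, Nat.find_spec h, fun k hk => not_lt.1 (Nat.find_min h hk)⟩
  have hm1 : 1 ≤ m := by
    rcases Nat.eq_zero_or_pos m with rfl | h
    · omega
    · exact h
  have hmJ : m ≤ J := by
    by_contra! h
    have := hmin J h
    omega
  have value : (a i : ℤ) = ((m : ℤ) + 1) * (i - a m) := by
    rcases lt_or_ge i 4 with h4 | h4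
    · have : m = 1 := by
        by_contra hne
        have := hmin 1 (by omega)
        omega
      subst this
      interval_cases i <;> simp [ha1, ha2, ha3]
    · have := ha i h4 m hm1 (hmin _ (by omega)) hm
      zify at this
      linarith
  refine ⟨⟨m, hm1, hmJ, value⟩, fun p hp hpJ => ?_⟩
  rw [value]
  rcases le_total m p with h | h
  · induction p, h using Nat.le_induction with
    | base => exact le_rfl
    | succ n hn ih =>
      have h1 := ih (by omega) (by omega)
      have h2 := step n (by omega)
      have h3 := mono m n hn (by omega)
      have : (i : ℤ) < c n := by exact_mod_cast hm.trans_le h3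
      linarith
  · have up : ∀ n, p ≤ n → n ≤ m →
        ((p : ℤ) + 1) * (i - a p) ≤ ((n : ℤ) + 1) * (i - a n) := by
      intro n hn
      induction n, hn using Nat.le_induction with
      | base => intro _; exact le_rfl
      | succ n hn ih =>
        intro hnm
        have h1 := ih (by omega)
        have h2 := step n (by omega)
        have : (c n : ℤ) ≤ i := by exact_mod_cast hmin n (by omega)
        linarith
    exact up m h le_rfl

/-- The breakpoints `c` are strictly increasing, because `a` is increasing and convex. -/
theorem breakpoints_increasing (a c : ℕ → ℕ)
    (ha1 : a 1 = 1) (ha2 : a 2 = 2) (ha3 : a 3 = 4)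
    (hc0 : c 0 = 2)
    (hc : ∀ j : ℕ, 1 ≤ j → c j + (j + 1) * a j = (j + 2) * a (j + 1))
    (ha : ∀ i : ℕ, 4 ≤ i → ∀ j : ℕ, 1 ≤ j → c (j - 1) ≤ i → i < c j →
      a i + (j + 1) * a j = (j + 1) * i) (j : ℕ) : c j < c (j + 1) := by
  have hc1 : c 1 = 4 := by
    have := hc 1 le_rfl
    norm_num [ha1, ha2] at this
    omega
  have hc2 : c 2 = 10 := by
    have := hc 2 (by norm_num)
    norm_num [ha2, ha3] at this
    omega
  induction j using Nat.strong_induction_on with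
  | _ j ih =>
    rcases (by omega : j = 0 ∨ j = 1 ∨ 2 ≤ j) with rfl | rfl | hj
    · rw [hc0, hc1]; norm_num
    · rw [hc1, hc2]; norm_num
    · have lower : ∀ k, 1 ≤ k → k ≤ j → k + 3 ≤ c k := by
        intro k hk
        induction k, hk using Nat.le_induction with
        | base => intro _; omega
        | succ k _ ihk =>
          intro hkj
          have := ihk (by omega)
          have := ih k (by omega)
          omega
      have hcj := lower j (by omega) le_rfl
      have key := eq_max_of_increasing a c ha1 ha2 ha3 hc0 hc ha j ih
      obtain ⟨⟨p, hp, hpj, hval⟩, -⟩ := key (j + 1) (by omega) (by omega)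
      have h0 := (key j hj (by omega)).2 p hp hpj
      have h2 := (key (j + 2) (by omega) (by omega)).2 p hp hpj
      have e1 := hc j (by omega)
      have e2 := hc (j + 1) (by omega)
      zify at e1 e2 ⊢
      push_cast at hval h0 h2
      have hconv : 2 * (a (j + 1) : ℤ) ≤ a j + a (j + 2) := by linarith
      have hinc : (a (j + 1) : ℤ) + 1 ≤ a (j + 2) := by
        have : (1 : ℤ) ≤ p := by exact_mod_cast hp
        linarith
      have hmul := mul_le_mul_of_nonneg_left hconv (by positivity : (0 : ℤ) ≤ (j : ℤ) + 1)
      rw [show j + 1 + 1 = j + 2 from rfl] at e2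
      linarith

theorem stmt7 (a c : ℕ → ℕ)
    (ha1 : a 1 = 1) (ha2 : a 2 = 2) (ha3 : a 3 = 4)
    (hc0 : c 0 = 2)
    (hc : ∀ j : ℕ, 1 ≤ j → c j + (j + 1) * a j = (j + 2) * a (j + 1))
    (ha : ∀ i : ℕ, 4 ≤ i → ∀ j : ℕ, 1 ≤ j → c (j - 1) ≤ i → i < c j →
      a i + (j + 1) * a j = (j + 1) * i) :
    ∀ n : ℕ, 1 ≤ n → ∀ i j : ℕ, 1 ≤ j → j ≤ i → i ≤ n →
      (j + 1) * a j + a i ≥ (j + 1) * i + (if i = 1 ∧ j = 1 then 1 else 0) := by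
  intro n _ i j hj hji _
  have hinc := breakpoints_increasing a c ha1 ha2 ha3 hc0 hc ha
  rcases (by omega : i = 1 ∨ 2 ≤ i) with rfl | hi
  · obtain rfl : j = 1 := by omega
    simp [ha1]
  · have hlt : ∀ k, k < c k := by
      intro k
      induction k with
      | zero => omega
      | succ k ih => have := hinc k; omega
    have h := (eq_max_of_increasing a c ha1 ha2 ha3 hc0 hc ha i (fun k _ => hinc k) i hi
      (hlt i)).2 j hj hji
    rw [if_neg (by omega)]
    zify
    linarith
end

section
/- For every n ≥ 1, the point α = (a_1, a_2, ..., a_n) is a vertex (extreme point) of the polyhedron P_n. -/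
theorem exists_segment {c : ℕ → ℕ} {i m : ℕ} (h0 : c 0 ≤ i) (hm : i < c m) :
    ∃ k, k + 1 ≤ m ∧ c k ≤ i ∧ i < c (k + 1) := by
  classical
  have hex : ∃ k, i < c k := ⟨m, hm⟩
  obtain ⟨k, hk⟩ : ∃ k, Nat.find hex = k + 1 := by
    refine Nat.exists_eq_succ_of_ne_zero fun h => ?_
    have := Nat.find_spec hex
    rw [h] at this
    omega
  refine ⟨k, hk ▸ Nat.find_min' hex hm, ?_, hk ▸ Nat.find_spec hex⟩
  exact not_lt.mp (Nat.find_min hex (by omega))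

theorem add_le_of_lt_succ {c : ℕ → ℕ} (h1 : c 1 = 4) {m : ℕ} (hmono : ∀ j < m, c j < c (j + 1)) :
    ∀ j, 1 ≤ j → j ≤ m → j + 3 ≤ c j := by
  intro j hj
  induction j, hj using Nat.le_induction with
  | base => intro _; omega
  | succ j hj ih =>
    intro hjm
    have := ih (by omega)
    have := hmono j (by omega)
    omega

section Recursion

variable {a c : ℕ → ℕ} (ha1 : a 1 = 1) (ha2 : a 2 = 2) (ha3 : a 3 = 4) (hc0 : c 0 = 2)
  (hc : ∀ j : ℕ, 1 ≤ j → c j + (j + 1) * a j = (j + 2) * a (j + 1))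
  (ha : ∀ i : ℕ, 4 ≤ i → ∀ j : ℕ, 1 ≤ j → c (j - 1) ≤ i → i < c j →
    a i + (j + 1) * a j = (j + 1) * i)

include ha1 ha2 hc in
theorem c_one : c 1 = 4 := by
  have := hc 1 le_rfl
  norm_num [ha1, ha2] at this
  omega

include ha1 ha2 ha3 hc ha in
/-- The recursion for `a` also holds at `2` and `3`, on initial ranges where `c` increases. -/
theorem a_of_segment {m k i : ℕ} (hmono : ∀ j < m, c j < c (j + 1)) (hk : k + 1 ≤ m)
    (hi : 2 ≤ i) (h1 : c k ≤ i) (h2 : i < c (k + 1)) :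
    a i + (k + 2) * a (k + 1) = (k + 2) * i := by
  rcases Nat.lt_or_ge i 4 with h | h
  · have hk0 : k = 0 := by
      by_contra hk0
      have := add_le_of_lt_succ (c_one ha1 ha2 hc) hmono k (by omega) (by omega)
      omega
    subst hk0
    interval_cases i <;> simp [ha1, ha2, ha3]
  · exact ha i h (k + 1) (by omega) h1 h2

include ha1 ha2 ha3 hc ha in
theorem a_succ_of_segment {m k i : ℕ} (hmono : ∀ j < m, c j < c (j + 1)) (hk : k + 1 ≤ m)
    (hi : 2 ≤ i) (h1 : c k ≤ i) (h2 : i < c (k + 1)) (h3 : i + 1 = c (k + 1) → k + 1 < m) :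
    a (i + 1) = a i + (k + 2) := by
  have e1 := a_of_segment ha1 ha2 ha3 hc ha hmono hk hi h1 h2
  rcases Nat.lt_or_ge (i + 1) (c (k + 1)) with h | h
  · have e2 := a_of_segment ha1 ha2 ha3 hc ha hmono hk (by omega : 2 ≤ i + 1) (by omega) h
    nlinarith
  · have h' : i + 1 = c (k + 1) := by omega
    have hlt := hmono (k + 1) (h3 h')
    have e2 := a_of_segment ha1 ha2 ha3 hc ha hmono (h3 h') (by omega : 2 ≤ i + 1)
      (by omega) (by omega)
    have e3 := hc (k + 1) (by omega)
    rw [← h'] at e3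
    nlinarith

include ha1 ha2 ha3 hc0 hc ha in
theorem c_lt_c_succ_of_forall_lt {m : ℕ} (hmono : ∀ j < m, c j < c (j + 1)) :
    c m < c (m + 1) := by
  have hc1 := c_one ha1 ha2 hc
  rcases Nat.eq_zero_or_pos m with rfl | hm
  · simp [hc0, hc1]
  have hbig := add_le_of_lt_succ hc1 hmono
  have hcm := hbig m hm le_rfl
  obtain ⟨k, hk, hk1, hk2⟩ := exists_segment (c := c) (i := m + 1) (m := m) (by omega) (by omega)
  have d1 := a_succ_of_segment ha1 ha2 ha3 hc ha hmono hk (by omega) hk1 hk2 (by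
    intro h
    rcases Nat.lt_or_ge (k + 1) m with h' | h'
    · exact h'
    · have : k + 1 = m := by omega
      rw [this] at h
      omega)
  have d0 : ∃ d ≤ k + 2, a (m + 1) = a m + d := by
    rcases Nat.lt_or_ge m 2 with h | h
    · have : m = 1 := by omega
      subst this
      exact ⟨1, by omega, by simp [ha1, ha2]⟩
    rcases Nat.lt_or_ge m (c k) with h' | h'
    · obtain ⟨l, rfl⟩ : ∃ l, k = l + 1 := Nat.exists_eq_succ_of_ne_zero (by rintro rfl; omega)
      have := hmono l (by omega)
      exact ⟨l + 2, by omega, a_succ_of_segment ha1 ha2 ha3 hc ha hmono (by omega) h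
        (by omega) h' (by omega)⟩
    · exact ⟨k + 2, le_rfl, a_succ_of_segment ha1 ha2 ha3 hc ha hmono hk h h' (by omega)
        (by omega)⟩
  obtain ⟨d, hd, hd'⟩ := d0
  have e0 := hc m hm
  have e1 := hc (m + 1) (by omega)
  rw [d1, hd'] at e1
  rw [hd'] at e0
  have : (m + 1) * d ≤ (m + 1) * (k + 2) := Nat.mul_le_mul_left _ hd
  nlinarith

include ha1 ha2 ha3 hc0 hc ha in
theorem c_strictMono : StrictMono c := by
  refine strictMono_nat_of_lt_succ fun n => ?_
  induction n using Nat.strong_induction_on with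
  | _ n ih => exact c_lt_c_succ_of_forall_lt ha1 ha2 ha3 hc0 hc ha ih

include ha1 ha2 ha3 hc0 hc ha in
theorem exists_tight {i : ℕ} (hi : 2 ≤ i) :
    ∃ k, k + 1 < i ∧ c k ≤ i ∧ i < c (k + 1) ∧ a i + (k + 2) * a (k + 1) = (k + 2) * i := by
  have hmono := c_strictMono ha1 ha2 ha3 hc0 hc ha
  have hlt : ∀ j, c j < c (j + 1) := fun j => hmono (Nat.lt_succ_self j)
  have hbig : ∀ j, j + 2 ≤ c j := by
    intro j
    induction j with
    | zero => omega
    | succ j ih => have := hlt j; omega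
  obtain ⟨k, hk, hk1, hk2⟩ := exists_segment (c := c) (i := i) (m := i) (by omega)
    (by have := hbig i; omega)
  exact ⟨k, by have := hbig k; omega, hk1, hk2,
    a_of_segment ha1 ha2 ha3 hc ha (fun j _ => hlt j) hk hi hk1 hk2⟩

include ha1 ha2 ha3 hc0 hc ha in
theorem a_feasible {i : ℕ} (hi : 2 ≤ i) (j : ℕ) :
    (j + 2) * i ≤ a i + (j + 2) * a (j + 1) := by
  have hmono := (c_strictMono ha1 ha2 ha3 hc0 hc ha).monotone
  obtain ⟨k, -, hk1, hk2, hk⟩ := exists_tight ha1 ha2 ha3 hc0 hc ha hi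
  rcases le_total k j with h | h
  · induction j, h using Nat.le_induction with
    | base => omega
    | succ j hj ih =>
      have h1 := hc (j + 1) (by omega)
      have h2 : c (k + 1) ≤ c (j + 1) := hmono (by omega)
      nlinarith
  · induction h using Nat.decreasingInduction with
    | self => omega
    | of_succ j hj ih =>
      have h1 := hc (j + 1) (by omega)
      have h2 : c (j + 1) ≤ c k := hmono (by omega)
      nlinarith

end Recursion

theorem eq_of_mem_openSegment_of_tight {p q r s t b : ℝ} {u v : ℝ} (hu : 0 < u) (hv : 0 < v)
    (huv : u + v = 1) (hp : b ≤ r * p + q) (hs : b ≤ r * s + t)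
    (h : r * (u * p + v * s) + (u * q + v * t) = b) : r * p + q = b := by
  have h' : u * (r * p + q - b) + v * (r * s + t - b) = 0 := by
    linear_combination h - b * huv
  nlinarith [mul_nonneg hv.le (sub_nonneg.mpr hs), mul_nonneg hu.le (sub_nonneg.mpr hp)]

theorem stmt11 (a c : ℕ → ℕ)
    (ha1 : a 1 = 1) (ha2 : a 2 = 2) (ha3 : a 3 = 4)
    (hc0 : c 0 = 2)
    (hc : ∀ j : ℕ, 1 ≤ j → c j + (j + 1) * a j = (j + 2) * a (j + 1))
    (ha : ∀ i : ℕ, 4 ≤ i → ∀ j : ℕ, 1 ≤ j → c (j - 1) ≤ i → i < c j →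
      a i + (j + 1) * a j = (j + 1) * i)
    (n : ℕ) (hn : 1 ≤ n) :
    (fun i : Fin n => (a ((i : ℕ) + 1) : ℝ)) ∈
      Set.extremePoints ℝ
        {x : Fin n → ℝ | ∀ i j : Fin n, j ≤ i →
          (((j : ℕ) : ℝ) + 2) * x j + x i ≥
            (((j : ℕ) : ℝ) + 2) * (((i : ℕ) : ℝ) + 1) +
              (if (i : ℕ) = 0 ∧ (j : ℕ) = 0 then 1 else 0)} := by
  have hfirst : ∀ i : ℕ, ¬ 2 ≤ i + 1 → i = 0 := fun i h => by omega
  rw [mem_extremePoints_iff_left]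
  refine ⟨fun i j hij => ?_, fun x hx y hy hxy => ?_⟩
  · have hij' : (j : ℕ) ≤ i := hij
    by_cases hi : 2 ≤ (i : ℕ) + 1
    · have h := a_feasible ha1 ha2 ha3 hc0 hc ha hi j
      rw [if_neg (by omega)]
      have h' : (((j : ℕ) : ℝ) + 2) * (((i : ℕ) : ℝ) + 1) ≤
          a ((i : ℕ) + 1) + (((j : ℕ) : ℝ) + 2) * a ((j : ℕ) + 1) := by exact_mod_cast h
      simp only [ge_iff_le]
      linarith
    · have hi0 := hfirst _ hi
      have hj0 : (j : ℕ) = 0 := by omega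
      norm_num [hi0, hj0, ha1]
  · obtain ⟨u, v, hu, hv, huv, hsum⟩ := hxy
    have hcomb : ∀ i : Fin n, u * x i + v * y i = a ((i : ℕ) + 1) := fun i => congrFun hsum i
    have key : ∀ m : ℕ, ∀ hm : m < n, x ⟨m, hm⟩ = a (m + 1) := by
      intro m
      induction m using Nat.strong_induction_on with
      | _ m ih =>
        intro hm
        by_cases h2 : 2 ≤ m + 1
        · obtain ⟨k, hkm, -, -, hk⟩ := exists_tight ha1 ha2 ha3 hc0 hc ha h2
          have hkn : k < n := by omega
          have hle : (⟨k, hkn⟩ : Fin n) ≤ ⟨m, hm⟩ := Fin.mk_le_mk.mpr (by omega)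
          have hx' := hx ⟨m, hm⟩ ⟨k, hkn⟩ hle
          have hy' := hy ⟨m, hm⟩ ⟨k, hkn⟩ hle
          have hk' : (a (m + 1) : ℝ) + ((k : ℝ) + 2) * a (k + 1) = ((k : ℝ) + 2) * (m + 1) := by
            exact_mod_cast hk
          simp only [show ¬ (m = 0 ∧ k = 0) by omega, if_false, add_zero] at hx' hy'
          have := eq_of_mem_openSegment_of_tight hu hv huv hx' hy'
            (by rw [hcomb, hcomb]; simp only; linarith)
          rw [ih k (by omega) hkn] at this
          linarith
        · obtain rfl := hfirst m h2
          have hx' := hx ⟨0, hm⟩ ⟨0, hm⟩ le_rfl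
          have hy' := hy ⟨0, hm⟩ ⟨0, hm⟩ le_rfl
          have h0 := hcomb ⟨0, hm⟩
          norm_num [ha1] at hx' hy' h0 ⊢
          have := eq_of_mem_openSegment_of_tight hu hv huv hx' hy' (by rw [h0]; norm_num)
          linarith
    funext i
    exact key i i.isLt
end

section
/- For integers j ≥ 3 and k ≥ 1 with c_{k−1} < j ≤ c_k, one has the identity c_{j−1} − 2·a_j = (k+1)·a_k; in particular c_{j−1} − 2·a_j > 0. -/
/-- The recursion for `a` yields a second-order relation between `a (i + 1)`, `a i` and `a k`,
as soon as `c` increases up to the index `k + 1`. -/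
theorem mul_succ_eq_of_mem_block {a c : ℕ → ℕ}
    (ha1 : a 1 = 1) (ha2 : a 2 = 2) (ha3 : a 3 = 4) (hc1 : c 1 = 4)
    (hc : ∀ j : ℕ, 1 ≤ j → c j + (j + 1) * a j = (j + 2) * a (j + 1))
    (ha : ∀ i : ℕ, 4 ≤ i → ∀ j : ℕ, 1 ≤ j → c (j - 1) ≤ i → i < c j →
      a i + (j + 1) * a j = (j + 1) * i)
    {i k : ℕ} (hi : 2 ≤ i) (hk : 1 ≤ k) (hmono : ∀ m ≤ k, c m < c (m + 1))
    (hlow : c (k - 1) ≤ i) (hup : i + 1 ≤ c k) :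
    i * a (i + 1) = (i + 1) * a i + (k + 1) * a k := by
  have hk_one : i ≤ 3 → k = 1 := by
    intro hi3
    by_contra hne
    have hle : ∀ m, m + 1 ≤ k → 4 ≤ c (m + 1) := by
      intro m
      induction m with
      | zero => intro _; simp [hc1]
      | succ m ih =>
        intro h
        have := ih (by omega)
        have := hmono (m + 1) (by omega)
        omega
    have := hle (k - 2) (by omega)
    rw [show k - 2 + 1 = k - 1 by omega] at this
    omega
  have hai : a i + (k + 1) * a k = (k + 1) * i := by
    by_cases h4 : 4 ≤ i
    · exact ha i h4 k hk hlow hup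
    · obtain rfl := hk_one (by omega)
      interval_cases i <;> simp [ha1, ha2, ha3]
  have hai' : a (i + 1) + (k + 1) * a k = (k + 1) * (i + 1) := by
    by_cases h4 : 4 ≤ i + 1
    · rcases hup.lt_or_eq with hlt | heq
      · exact ha (i + 1) h4 k hk (by omega) hlt
      · have h := ha (i + 1) h4 (k + 1) (by omega) (by simp [heq])
          (by rw [heq]; exact hmono k le_rfl)
        have h' := hc k hk
        rw [← heq] at h'
        linarith
    · obtain rfl : i = 2 := by omega
      obtain rfl := hk_one (by omega)
      simp [ha1, ha3]
  zify at *
  linear_combination (i : ℤ) * hai' - (i + 1 : ℤ) * hai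

/-- Both sequences are strictly increasing. -/
theorem strict_increase {a c : ℕ → ℕ}
    (ha1 : a 1 = 1) (ha2 : a 2 = 2) (ha3 : a 3 = 4) (hc0 : c 0 = 2)
    (hc1 : c 1 = 4) (hc2 : c 2 = 10)
    (hc : ∀ j : ℕ, 1 ≤ j → c j + (j + 1) * a j = (j + 2) * a (j + 1))
    (ha : ∀ i : ℕ, 4 ≤ i → ∀ j : ℕ, 1 ≤ j → c (j - 1) ≤ i → i < c j →
      a i + (j + 1) * a j = (j + 1) * i) (n : ℕ) :
    0 < a (n + 1) ∧ a (n + 1) < a (n + 2) ∧ c n < c (n + 1) := by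
  induction n using Nat.strong_induction_on with
  | _ n ih =>
  by_cases hn : n < 2
  · interval_cases n <;> simp [*]
  push Not at hn
  have hgrow : ∀ m, m + 1 ≤ n → m + 4 ≤ c (m + 1) := by
    intro m
    induction m with
    | zero => intro _; simp [hc1]
    | succ m ihm =>
      intro h
      have := ihm (by omega)
      have := (ih (m + 1) (by omega)).2.2
      omega
  have hbig : n + 2 ≤ c (n - 1) := by
    have := hgrow (n - 2) (by omega)
    rw [show n - 2 + 1 = n - 1 by omega] at this
    omega
  have hpos : 0 < a (n + 1) := by
    have := (ih (n - 1) (by omega)).2.1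
    rw [show n - 1 + 2 = n + 1 by omega] at this
    omega
  have hex : ∃ k, n + 1 ≤ c k := ⟨n - 1, by omega⟩
  obtain ⟨k, hk, hkmin⟩ : ∃ k, n + 1 ≤ c k ∧ ∀ m < k, c m < n + 1 :=
    ⟨Nat.find hex, Nat.find_spec hex, fun m hm => not_le.mp (Nat.find_min hex hm)⟩
  have hk1 : 1 ≤ k := by
    by_contra h
    obtain rfl : k = 0 := by omega
    omega
  have hkn : k ≤ n - 1 := by
    by_contra h
    have := hkmin (n - 1) (by omega)
    omega
  have hlow := hkmin (k - 1) (by omega)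
  have hak : 0 < a k ∧ a k < a (k + 1) := by
    have := ih (k - 1) (by omega)
    rw [show k - 1 + 1 = k by omega, show k - 1 + 2 = k + 1 by omega] at this
    exact ⟨this.1, this.2.1⟩
  have h1 := mul_succ_eq_of_mem_block ha1 ha2 ha3 hc1 hc ha hn hk1
    (fun m hm => (ih m (by omega)).2.2) (by omega) hk
  have h2 : ∃ d, 0 < d ∧ (k + 1) * a k ≤ d ∧
      (n + 1) * a (n + 2) = (n + 2) * a (n + 1) + d := by
    by_cases hle : n + 2 ≤ c k
    · exact ⟨_, Nat.mul_pos (by omega) hak.1, le_rfl,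
        mul_succ_eq_of_mem_block ha1 ha2 ha3 hc1 hc ha (by omega) hk1
          (fun m hm => (ih m (by omega)).2.2) (by omega) hle⟩
    · have hne : k ≠ n - 1 := by rintro rfl; omega
      have hstep := (ih k (by omega)).2.2
      refine ⟨(k + 1 + 1) * a (k + 1), Nat.mul_pos (by omega) (by omega),
        Nat.mul_le_mul (by omega) hak.2.le,
        mul_succ_eq_of_mem_block ha1 ha2 ha3 hc1 hc ha (by omega) (by omega)
          (fun m hm => (ih m (by omega)).2.2) ?_ (by omega)⟩
      simp only [Nat.add_sub_cancel]
      omega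
  obtain ⟨d, hd0, hd, h2⟩ := h2
  have hlt : a (n + 1) < a (n + 2) := by
    by_contra h
    push Not at h
    nlinarith
  refine ⟨hpos, hlt, ?_⟩
  have e1 := hc n (by omega)
  have e2 := hc (n + 1) (by omega)
  rw [show n + 1 + 1 = n + 2 by omega] at e2
  nlinarith

theorem stmt14 (a c : ℕ → ℕ)
    (ha1 : a 1 = 1) (ha2 : a 2 = 2) (ha3 : a 3 = 4)
    (hc0 : c 0 = 2)
    (hc : ∀ j : ℕ, 1 ≤ j → c j + (j + 1) * a j = (j + 2) * a (j + 1))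
    (ha : ∀ i : ℕ, 4 ≤ i → ∀ j : ℕ, 1 ≤ j → c (j - 1) ≤ i → i < c j →
      a i + (j + 1) * a j = (j + 1) * i) :
    ∀ j k : ℕ, 3 ≤ j → 1 ≤ k → c (k - 1) < j → j ≤ c k →
      (c (j - 1) : ℤ) - 2 * a j = ((k : ℤ) + 1) * a k ∧
      0 < (c (j - 1) : ℤ) - 2 * a j := by
  intro j k hj hk hlow hup
  have hc1 : c 1 = 4 := by have := hc 1 le_rfl; simp [ha1, ha2] at this; omega
  have hc2 : c 2 = 10 := by have := hc 2 (by omega); simp [ha2, ha3] at this; omega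
  have hinc := strict_increase ha1 ha2 ha3 hc0 hc1 hc2 hc ha
  obtain ⟨i, rfl⟩ : ∃ i, j = i + 1 := ⟨j - 1, by omega⟩
  have h := mul_succ_eq_of_mem_block ha1 ha2 ha3 hc1 hc ha (i := i) (by omega) hk
    (fun m _ => (hinc m).2.2) (by omega) hup
  have e := hc i (by omega)
  have hpos : 0 < a k := by
    have := (hinc (k - 1)).1
    rwa [Nat.sub_add_cancel hk] at this
  have key : (c (i + 1 - 1) : ℤ) - 2 * a (i + 1) = ((k : ℤ) + 1) * a k := by
    simp only [Nat.add_sub_cancel]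
    zify at h e
    linear_combination h + e
  exact ⟨key, by rw [key]; positivity⟩
end

section
/- For integers j ≥ 3 and k ≥ 1 with c_{k−1} < j ≤ c_k: if j < c_k then (j+1) − (c_j − c_{j−1}) = j − 2k − 1 ≥ 0, while if j = c_k then (j+1) − (c_j − c_{j−1}) = −2k − 3 < 0. -/
/-- Two consecutive pieces of the recursion agree at the breakpoint `c k`, so the affine formula
for `a` with slope `k + 1` holds on the closed interval `[c (k - 1), c k]`. -/
theorem affine_on_piece {a c : ℕ → ℕ}
    (ha1 : a 1 = 1) (ha2 : a 2 = 2) (ha3 : a 3 = 4) (hc0 : c 0 = 2)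
    (hc : ∀ j : ℕ, 1 ≤ j → c j + (j + 1) * a j = (j + 2) * a (j + 1))
    (ha : ∀ i : ℕ, 4 ≤ i → ∀ j : ℕ, 1 ≤ j → c (j - 1) ≤ i → i < c j →
      a i + (j + 1) * a j = (j + 1) * i)
    {k : ℕ} (hlow : ∀ m ≤ k, 2 * m + 2 ≤ c m) (hstep : c k < c (k + 1))
    (hk : 1 ≤ k) {i : ℕ} (hi : c (k - 1) ≤ i) (hik : i ≤ c k) :
    a i + (k + 1) * a k = (k + 1) * i := by
  have h4 : 4 ≤ c k := by have := hlow k le_rfl; omega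
  rcases hik.lt_or_eq with hlt | rfl
  · by_cases hi4 : 4 ≤ i
    · exact ha i hi4 k hk hi hlt
    · have h1 : k = 1 := by
        have := hlow (k - 1) (by omega)
        omega
      subst h1
      have : i = 2 ∨ i = 3 := by
        simp only [Nat.sub_self, hc0] at hi
        omega
      rcases this with rfl | rfl <;> simp [ha1, ha2, ha3]
  · have e := ha (c k) h4 (k + 1) (by omega) (by simp) hstep
    have e' := hc k hk
    nlinarith

theorem breakpoint_sub {a c : ℕ → ℕ}
    (ha1 : a 1 = 1) (ha2 : a 2 = 2) (ha3 : a 3 = 4) (hc0 : c 0 = 2)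
    (hc : ∀ j : ℕ, 1 ≤ j → c j + (j + 1) * a j = (j + 2) * a (j + 1))
    (ha : ∀ i : ℕ, 4 ≤ i → ∀ j : ℕ, 1 ≤ j → c (j - 1) ≤ i → i < c j →
      a i + (j + 1) * a j = (j + 1) * i)
    {k : ℕ} (hlow : ∀ m ≤ k, 2 * m + 2 ≤ c m) (hstep : c k + 2 ≤ c (k + 1))
    (hk : 1 ≤ k) {n : ℕ} (hn : 2 ≤ n) (h1 : c (k - 1) ≤ n) (h2 : n + 1 ≤ c k) :
    (n + 1 < c k → c (n + 1) = c n + 2 * (k + 1)) ∧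
    (n + 1 = c k → c (n + 1) = c n + 2 * (k + 1) + (n + 3)) := by
  have A {i : ℕ} := affine_on_piece (i := i) ha1 ha2 ha3 hc0 hc ha hlow (by omega) hk
  have e0 := A h1 (by omega)
  have e1 := A (i := n + 1) (by omega) h2
  have d1 : a (n + 1) = a n + (k + 1) := by linarith
  have f0 := hc n (by omega)
  have f1 := hc (n + 1) (by omega)
  constructor <;> intro h
  · have e2 := A (i := n + 2) (by omega) (by omega)
    have d2 : a (n + 1 + 1) = a n + 2 * (k + 1) := by
      change a (n + 2) = _
      linarith
    rw [d2, d1] at f1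
    rw [d1] at f0
    linarith
  · have h4 : 4 ≤ c k := by have := hlow k le_rfl; omega
    have e1' := ha (n + 1) (by omega) (k + 1) (by omega) (by simp [h]) (by omega)
    have e2 := ha (n + 2) (by omega) (k + 1) (by omega) (by simp; omega) (by omega)
    have d2 : a (n + 1 + 1) = a n + (k + 1) + (k + 2) := by
      change a (n + 2) = _
      linarith
    rw [d2, d1] at f1
    rw [d1] at f0
    linarith

theorem two_mul_add_two_le_of_step {c : ℕ → ℕ} (hc0 : c 0 = 2) {n : ℕ}
    (h : ∀ m < n, c m + 2 ≤ c (m + 1)) : ∀ m ≤ n, 2 * m + 2 ≤ c m := by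
  intro m
  induction m with
  | zero => simp [hc0]
  | succ m ih =>
    intro hm
    have := ih (by omega)
    have := h m (by omega)
    omega

theorem breakpoint_step {a c : ℕ → ℕ}
    (ha1 : a 1 = 1) (ha2 : a 2 = 2) (ha3 : a 3 = 4) (hc0 : c 0 = 2)
    (hc : ∀ j : ℕ, 1 ≤ j → c j + (j + 1) * a j = (j + 2) * a (j + 1))
    (ha : ∀ i : ℕ, 4 ≤ i → ∀ j : ℕ, 1 ≤ j → c (j - 1) ≤ i → i < c j →
      a i + (j + 1) * a j = (j + 1) * i) (n : ℕ) :
    c n + 2 ≤ c (n + 1) := by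
  induction n using Nat.strong_induction_on with
  | _ n ih =>
    have c1 : c 1 = 4 := by
      have := hc 1 le_rfl
      norm_num [ha1, ha2] at this
      omega
    have c2 : c 2 = 10 := by
      have := hc 2 (by omega)
      norm_num [ha2, ha3] at this
      omega
    by_cases hn : n < 2
    · interval_cases n <;> simp [hc0, c1, c2]
    have hlow := two_mul_add_two_le_of_step hc0 ih
    have hex : ∃ k, n + 1 ≤ c k := ⟨n, by have := hlow n le_rfl; omega⟩
    obtain ⟨k, hk, hmin⟩ : ∃ k, n + 1 ≤ c k ∧ ∀ m < k, ¬ n + 1 ≤ c m :=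
      ⟨Nat.find hex, Nat.find_spec hex, fun m hm => Nat.find_min hex hm⟩
    have hk0 : 1 ≤ k := by
      by_contra h0
      obtain rfl : k = 0 := by omega
      omega
    have hprev := hmin (k - 1) (by omega)
    have hkn : k < n := by
      by_contra h
      have := hmin (n - 1)
      have := hlow (n - 1) (by omega)
      omega
    obtain ⟨hlt, heq⟩ := breakpoint_sub ha1 ha2 ha3 hc0 hc ha
      (fun m hm => hlow m (by omega)) (ih k hkn) hk0 (by omega) (by omega) hk
    rcases hk.lt_or_eq with h | h
    · have := hlt h
      omega
    · have := heq h
      omega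


theorem stmt15 (a c : ℕ → ℕ)
    (ha1 : a 1 = 1) (ha2 : a 2 = 2) (ha3 : a 3 = 4)
    (hc0 : c 0 = 2)
    (hc : ∀ j : ℕ, 1 ≤ j → c j + (j + 1) * a j = (j + 2) * a (j + 1))
    (ha : ∀ i : ℕ, 4 ≤ i → ∀ j : ℕ, 1 ≤ j → c (j - 1) ≤ i → i < c j →
      a i + (j + 1) * a j = (j + 1) * i) :
    ∀ j k : ℕ, 3 ≤ j → 1 ≤ k → c (k - 1) < j → j ≤ c k →
      (j < c k →
        ((j : ℤ) + 1) - ((c j : ℤ) - c (j - 1)) = (j : ℤ) - 2 * k - 1 ∧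
        0 ≤ (j : ℤ) - 2 * k - 1) ∧
      (j = c k →
        ((j : ℤ) + 1) - ((c j : ℤ) - c (j - 1)) = -2 * (k : ℤ) - 3 ∧
        -2 * (k : ℤ) - 3 < 0) := by
  intro j k hj hk h1 h2
  have hstep := breakpoint_step ha1 ha2 ha3 hc0 hc ha
  have hlow (m : ℕ) := two_mul_add_two_le_of_step hc0 (fun i _ => hstep i) m le_rfl
  obtain ⟨n, rfl⟩ : ∃ n, j = n + 1 := ⟨j - 1, by omega⟩
  obtain ⟨hlt, heq⟩ := breakpoint_sub ha1 ha2 ha3 hc0 hc ha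
    (fun m _ => hlow m) (hstep k) hk (by omega) (by omega) h2
  have hprev := hlow (k - 1)
  rw [Nat.add_sub_cancel]
  refine ⟨fun h => ?_, fun h => ?_⟩
  · have := hlt h
    omega
  · have := heq h
    omega
end

section
/- Define e_j = (j+1)·c_{j−1}·(c_{j−1} − 2a_j) + [(j+1) − (c_j − c_{j−1})]·a_j². Then e_j > 0 for every integer j ≥ 3 with j ∉ {4, 10, 14}; consequently, for such j, 1/a_j² − (c_j − c_{j−1})/((j+1)·(c_{j−1} − a_j)²) > 0. -/
/-- The integer form of the defining recursion, with the indices `j` of `c` and of the blocks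
shifted so that no subtraction occurs. -/
structure IsBlockRecursion (a c : ℕ → ℤ) : Prop where
  a_one : a 1 = 1
  a_two : a 2 = 2
  a_three : a 3 = 4
  c_zero : c 0 = 2
  c_succ : ∀ j : ℕ, c (j + 1) = (j + 3) * a (j + 2) - (j + 2) * a (j + 1)
  block : ∀ i j : ℕ, 4 ≤ i → c j ≤ i → (i : ℤ) < c (j + 1) → a i = (j + 2) * (i - a (j + 1))

namespace IsBlockRecursion

variable {a c : ℕ → ℤ}

theorem c_one (h : IsBlockRecursion a c) : c 1 = 4 := by
  have := h.c_succ 0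
  norm_num [h.a_one, h.a_two] at this
  exact this

theorem c_two (h : IsBlockRecursion a c) : c 2 = 10 := by
  have := h.c_succ 1
  norm_num [h.a_three, h.a_two] at this
  exact this

theorem a_four (h : IsBlockRecursion a c) : a 4 = 6 := by
  have := h.block 4 1 le_rfl (by rw [h.c_one]; norm_num) (by rw [h.c_two]; norm_num)
  norm_num [h.a_two] at this
  exact this

theorem c_three (h : IsBlockRecursion a c) : c 3 = 14 := by
  have := h.c_succ 2
  norm_num [h.a_three, h.a_four] at this
  exact this

theorem a_five (h : IsBlockRecursion a c) : a 5 = 9 := by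
  have := h.block 5 1 (by norm_num) (by rw [h.c_one]; norm_num) (by rw [h.c_two]; norm_num)
  norm_num [h.a_two] at this
  exact this

/-- The linear formulas of two consecutive blocks agree at the common endpoint, so the formula of
a block holds at its right endpoint as well. -/
theorem block_closed (h : IsBlockRecursion a c) {i j : ℕ} (hi : 4 ≤ i) (hl : c j ≤ i)
    (hr : (i : ℤ) ≤ c (j + 1)) (hc : c (j + 1) < c (j + 2)) :
    a i = (j + 2) * (i - a (j + 1)) := by
  rcases hr.lt_or_eq with hlt | heq
  · exact h.block i j hi hl hlt
  · have h1 := h.block i (j + 1) hi heq.ge (heq ▸ hc)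
    have h2 := h.c_succ j
    push_cast at h1
    rw [← heq] at h2
    linear_combination h1 + h2

theorem differences (h : IsBlockRecursion a c) {n j : ℕ} (hn : 4 ≤ n) (hl : c j ≤ n)
    (hr : (n : ℤ) < c (j + 1)) (hc : n + 2 < c (j + 1) ∨ c (j + 1) + 2 ≤ c (j + 2)) :
    a n = (j + 2) * (n - a (j + 1)) ∧ a (n + 1) - a n = j + 2 ∧
      ((n + 1 < c (j + 1) ∧ a (n + 2) - a (n + 1) = j + 2) ∨
        (n + 1 = c (j + 1) ∧ a (n + 2) - a (n + 1) = j + 3)) := by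
  have h0 := h.block n j hn hl hr
  rcases hc with hc | hc
  · have h1 := h.block (n + 1) j (by omega) (by push_cast; omega) (by push_cast; omega)
    have h2 := h.block (n + 2) j (by omega) (by push_cast; omega) (by push_cast; omega)
    push_cast at h1 h2
    exact ⟨h0, by linear_combination h1 - h0,
      .inl ⟨by omega, by linear_combination h2 - h1⟩⟩
  · have h1 := h.block_closed (i := n + 1) (j := j) (by omega) (by push_cast; omega)
      (by push_cast; omega) (by omega)
    push_cast at h1
    refine ⟨h0, by linear_combination h1 - h0, ?_⟩
    by_cases h3 : n + 1 < c (j + 1)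
    · have h2 := h.block_closed (i := n + 2) (j := j) (by omega) (by push_cast; omega)
        (by push_cast; omega) (by omega)
      push_cast at h2
      exact .inl ⟨h3, by linear_combination h2 - h1⟩
    · have h4 : (n : ℤ) + 1 = c (j + 1) := by omega
      have h1' := h.block (n + 1) (j + 1) (by omega) (by push_cast; omega)
        (by push_cast; rw [show j + 1 + 1 = j + 2 from rfl]; omega)
      have h2 := h.block (n + 2) (j + 1) (by omega) (by push_cast; omega)
        (by push_cast; rw [show j + 1 + 1 = j + 2 from rfl]; omega)
      push_cast at h1' h2
      exact .inr ⟨h4, by linear_combination h2 - h1'⟩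

theorem c_succ_eq_add (h : IsBlockRecursion a c) (j : ℕ) :
    c (j + 1) = a (j + 1) + (j + 3) * (a (j + 2) - a (j + 1)) := by
  rw [h.c_succ]; ring

theorem c_gap_of_convex (h : IsBlockRecursion a c) {k : ℕ} (h1 : 1 ≤ a (k + 2) - a (k + 1))
    (h2 : a (k + 2) - a (k + 1) ≤ a (k + 3) - a (k + 2)) : c (k + 1) + 2 ≤ c (k + 2) := by
  have e1 := h.c_succ k
  have e2 := h.c_succ (k + 1)
  push_cast at e2
  have := mul_le_mul_of_nonneg_left h2 (by positivity : (0 : ℤ) ≤ k + 4)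
  simp only [add_assoc, Nat.reduceAdd] at e1 e2
  linarith

theorem exists_block (h : IsBlockRecursion a c) {n m : ℕ} (hn : 2 ≤ n) (hm : (n : ℤ) < c (m + 1)) :
    ∃ j ≤ m, c j ≤ n ∧ (n : ℤ) < c (j + 1) := by
  classical
  have hex : ∃ j, (n : ℤ) < c (j + 1) := ⟨m, hm⟩
  refine ⟨Nat.find hex, Nat.find_min' hex hm, ?_, Nat.find_spec hex⟩
  rcases hj : Nat.find hex with _ | j
  · rw [h.c_zero]; exact_mod_cast hn
  · exact not_lt.mp (Nat.find_min hex (m := j) (by omega))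

theorem convex (h : IsBlockRecursion a c) (n : ℕ) :
    1 ≤ a (n + 2) - a (n + 1) ∧ a (n + 2) - a (n + 1) ≤ a (n + 3) - a (n + 2) := by
  induction n using Nat.strong_induction_on with
  | _ n ih =>
    obtain hn | hn := Nat.lt_or_ge n 3
    · interval_cases n <;> norm_num [h.a_one, h.a_two, h.a_three, h.a_four, h.a_five]
    have hpos : 1 ≤ a (n + 2) - a (n + 1) := by
      obtain ⟨m, rfl⟩ : ∃ m, n = m + 1 := ⟨n - 1, by omega⟩
      have := ih m (by omega)
      simp only [add_assoc, Nat.reduceAdd] at *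
      omega
    have ha : ∀ k ≤ n, (k : ℤ) + 1 ≤ a (k + 1) := by
      intro k
      induction k with
      | zero => intro _; norm_num [h.a_one]
      | succ k ihk =>
        intro hk
        have h1 := ihk (by omega)
        have h2 := (ih k (by omega)).1
        simp only [add_assoc, Nat.reduceAdd] at *
        push_cast
        omega
    have hcn : (n : ℤ) + 3 < c (n + 1) := by
      have h1 := h.c_succ_eq_add n
      have h2 := ha n le_rfl
      nlinarith
    obtain ⟨j, hj, hl, hr⟩ := h.exists_block (n := n + 1) (m := n) (by omega)
      (by push_cast; omega)
    have hgap : ((n + 1 : ℕ) : ℤ) + 2 < c (j + 1) ∨ c (j + 1) + 2 ≤ c (j + 2) := by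
      rcases hj.lt_or_eq with hlt | rfl
      · exact .inr (h.c_gap_of_convex (ih j hlt).1 (ih j hlt).2)
      · left; push_cast; omega
    obtain ⟨-, h1, h2⟩ := h.differences (by omega) hl hr hgap
    simp only [add_assoc, Nat.reduceAdd] at h1 h2
    refine ⟨hpos, ?_⟩
    omega

theorem c_gap (h : IsBlockRecursion a c) (j : ℕ) : c j + 2 ≤ c (j + 1) := by
  rcases j with _ | j
  · rw [h.c_zero, h.c_one]; norm_num
  · exact h.c_gap_of_convex (h.convex j).1 (h.convex j).2

theorem succ_le_a (h : IsBlockRecursion a c) (k : ℕ) : (k : ℤ) + 1 ≤ a (k + 1) := by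
  induction k with
  | zero => norm_num [h.a_one]
  | succ k ih =>
    have := (h.convex k).1
    simp only [add_assoc, Nat.reduceAdd] at *
    push_cast
    omega

theorem a_le_mul_difference (h : IsBlockRecursion a c) (k : ℕ) :
    a (k + 1) ≤ (k + 1) * (a (k + 2) - a (k + 1)) := by
  induction k with
  | zero => norm_num [h.a_one, h.a_two]
  | succ k ih =>
    have := (h.convex k).2
    have := mul_le_mul_of_nonneg_left this (by positivity : (0 : ℤ) ≤ k + 2)
    simp only [add_assoc, Nat.reduceAdd] at *
    push_cast
    linarith

theorem two_mul_a_le_c (h : IsBlockRecursion a c) (j : ℕ) : 2 * a (j + 1) ≤ c j := by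
  rcases j with _ | j
  · norm_num [h.a_one, h.c_zero]
  · have h1 := h.c_succ_eq_add j
    have h2 := h.a_le_mul_difference j
    simp only [add_assoc, Nat.reduceAdd] at *
    linarith

theorem exists_block_of_two_le (h : IsBlockRecursion a c) {n : ℕ} (hn : 2 ≤ n) :
    ∃ j, c j ≤ n ∧ (n : ℤ) < c (j + 1) := by
  have h1 := h.two_mul_a_le_c (n + 1)
  have h2 := h.succ_le_a (n + 1)
  push_cast at h2
  obtain ⟨j, -, hj⟩ := h.exists_block hn (m := n) (by omega)
  exact ⟨j, hj⟩

/-- `n * (a (n + 1) - a n) ≤ 2 * a n` for `n ≥ 4`. -/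
theorem mul_difference_le (h : IsBlockRecursion a c) {n : ℕ} (hn : 4 ≤ n) :
    n * (a (n + 1) - a n) ≤ 2 * a n := by
  obtain ⟨j, hl, hr⟩ := h.exists_block_of_two_le (n := n) (by omega)
  obtain ⟨h0, h1, -⟩ := h.differences hn hl hr (.inr (h.c_gap _))
  have h2 := h.two_mul_a_le_c j
  rw [h1, h0]
  nlinarith

theorem three_le_difference (h : IsBlockRecursion a c) (n : ℕ) : 3 ≤ a (n + 5) - a (n + 4) := by
  induction n with
  | zero => norm_num [h.a_four, h.a_five]
  | succ n ih =>
    have := (h.convex (n + 3)).2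
    simp only [add_assoc, Nat.reduceAdd] at *
    omega

/-- Positivity of `e i` when `a i = x` and both neighbouring differences of `a` equal `d`. -/
theorem interior_pos {i d x : ℤ} (hi : 0 < i) (hx : 0 < x) (hd : 2 * d ≤ i + 1) (hlt : x < i * d) :
    0 < (i + 1) * (x + i * d) * (x + i * d - 2 * x) + (i + 1 - 2 * d) * x ^ 2 := by
  have h1 : 0 < (i * d) ^ 2 - x ^ 2 := by nlinarith
  have h2 : 0 < (i + 1) * ((i * d) ^ 2 - x ^ 2) := by positivity
  have h3 : 0 ≤ (i + 1 - 2 * d) * x ^ 2 := mul_nonneg (by linarith) (by positivity)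
  linarith

/-- Positivity of `e i` when `a i = m * u` and the differences of `a` before and after `i` are `m`
and `m + 1`. -/
theorem boundary_pos {i m u : ℤ} (hm : 0 < m) (hu : 0 < u) (hi : 4 * (m + 1) ≤ i)
    (hui : 4 * u ≤ 3 * i) :
    0 < (i + 1) * (m * u + i * m) * (m * u + i * m - 2 * (m * u)) +
      (i + 1 - (i + 2 * (m + 1))) * (m * u) ^ 2 := by
  have h1 : 16 * u ^ 2 ≤ 9 * i ^ 2 := by nlinarith
  have hi0 : 0 < i := by linarith
  have h2 : (2 * (i + 2 * m + 2)) * (16 * u ^ 2) ≤ (3 * i) * (9 * i ^ 2) :=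
    mul_le_mul (by linarith) h1 (by positivity) (by positivity)
  have h3 : 0 < (i + 1) * i ^ 2 - (i + 2 * m + 2) * u ^ 2 := by
    have : 0 < i ^ 3 := by positivity
    nlinarith
  have : 0 < m ^ 2 * ((i + 1) * i ^ 2 - (i + 2 * m + 2) * u ^ 2) := by positivity
  linarith

theorem e_pos (h : IsBlockRecursion a c) (n : ℕ) (hn : 2 ≤ n) (h3 : n ≠ 3) (h9 : n ≠ 9)
    (h13 : n ≠ 13) :
    0 < ((n : ℤ) + 2) * c n * (c n - 2 * a (n + 1)) +
      ((n : ℤ) + 2 - (c (n + 1) - c n)) * a (n + 1) ^ 2 := by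
  obtain rfl | hn4 : n = 2 ∨ 4 ≤ n := by omega
  · norm_num [h.c_two, h.c_three, h.a_three]
  obtain ⟨p, rfl⟩ : ∃ p, n = p + 1 := ⟨n - 1, by omega⟩
  have ec := h.c_succ_eq_add (p + 1)
  have ec' := h.c_succ_eq_add p
  have hpos := h.succ_le_a (p + 1)
  obtain ⟨j, hl, hr⟩ := h.exists_block_of_two_le (n := p + 1) (by omega)
  obtain ⟨h0, h1, h2⟩ := h.differences hn4 hl hr (.inr (h.c_gap _))
  have hj := h.succ_le_a j
  simp only [add_assoc, Nat.reduceAdd] at *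
  push_cast at *
  rcases h2 with ⟨-, h2⟩ | ⟨heq, h2⟩
  · have e1 : c (p + 1) = a (p + 2) + (p + 2) * (j + 2) := by
      linear_combination ec' + (p + 3) * h1 - h1
    have e2 : c (p + 2) - c (p + 1) = 2 * (j + 2) := by
      linear_combination ec + (p + 4) * h2 - e1
    have hc := h.two_mul_a_le_c j
    have := interior_pos (i := p + 2) (d := j + 2) (x := a (p + 2)) (by positivity) (by linarith)
      (by linarith) (by nlinarith)
    rw [e2, e1]
    refine this.trans_eq ?_
    ring
  · have hj4 : 4 ≤ j + 1 := by
      by_contra! hlt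
      have : j ≤ 2 := by omega
      interval_cases j <;> norm_num [h.c_one, h.c_two, h.c_three] at heq <;> omega
    obtain ⟨q, rfl⟩ : ∃ q, j = q + 3 := ⟨j - 3, by omega⟩
    have e1 : c (p + 1) = a (p + 2) + (p + 2) * (q + 5) := by
      push_cast at h1
      linear_combination ec' + (p + 2) * h1
    have e2 : c (p + 2) - c (p + 1) = p + 2 + 2 * (q + 5 + 1) := by
      push_cast at h2
      linear_combination ec + (p + 4) * h2 - e1
    have es := h.c_succ_eq_add (q + 3)
    have hs := h.three_le_difference q
    have hA := h.mul_difference_le hj4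
    simp only [add_assoc, Nat.reduceAdd] at *
    push_cast at *
    have hu : (p : ℤ) + 2 - a (q + 4) = (q + 6) * (a (q + 5) - a (q + 4)) := by
      linear_combination heq + es
    have hqs : 0 ≤ (q : ℤ) * (a (q + 5) - a (q + 4)) :=
      mul_nonneg (by positivity) (by linarith)
    have hq3 := mul_le_mul_of_nonneg_left hs (by positivity : (0 : ℤ) ≤ q + 6)
    have e3 : a (p + 2) = (q + 5) * ((p : ℤ) + 2 - a (q + 4)) := by
      linear_combination h0 + h1
    have := boundary_pos (i := p + 2) (m := q + 5) (u := p + 2 - a (q + 4)) (by positivity)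
      (by linarith) (by linarith) (by linarith)
    rw [e2, e1, e3]
    refine this.trans_eq ?_
    ring

end IsBlockRecursion


theorem stmt16 (a c : ℕ → ℕ)
    (ha1 : a 1 = 1) (ha2 : a 2 = 2) (ha3 : a 3 = 4)
    (hc0 : c 0 = 2)
    (hc : ∀ j : ℕ, 1 ≤ j → c j + (j + 1) * a j = (j + 2) * a (j + 1))
    (ha : ∀ i : ℕ, 4 ≤ i → ∀ j : ℕ, 1 ≤ j → c (j - 1) ≤ i → i < c j →
      a i + (j + 1) * a j = (j + 1) * i) :
    ∀ j : ℕ, 3 ≤ j → j ≠ 4 → j ≠ 10 → j ≠ 14 →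
      0 < ((j : ℤ) + 1) * c (j - 1) * ((c (j - 1) : ℤ) - 2 * a j) +
          (((j : ℤ) + 1) - ((c j : ℤ) - c (j - 1))) * (a j : ℤ) ^ 2 ∧
      0 < 1 / (a j : ℝ) ^ 2 -
          ((c j : ℝ) - c (j - 1)) / (((j : ℝ) + 1) * ((c (j - 1) : ℝ) - a j) ^ 2) := by
  intro j hj h4 h10 h14
  have h : IsBlockRecursion (fun n => (a n : ℤ)) (fun n => (c n : ℤ)) := by
    refine ⟨by simp [ha1], by simp [ha2], by simp [ha3], by simp [hc0], fun j => ?_,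
      fun i j hi hl hr => ?_⟩
    · have := hc (j + 1) (by omega)
      zify at this
      linear_combination this
    · have := ha i hi (j + 1) (by omega) (by simpa using hl) (by exact_mod_cast hr)
      zify at this
      linear_combination this
  obtain ⟨n, rfl⟩ : ∃ n, j = n + 2 := ⟨j - 2, by omega⟩
  have he := h.e_pos (n + 1) (by omega) (by omega) (by omega) (by omega)
  have hpos := h.succ_le_a (n + 1)
  have hstep := h.c_succ_eq_add n
  have hd := (h.convex n).1
  simp only [add_assoc, Nat.reduceAdd, Nat.add_one_sub_one] at *
  push_cast at *
  have he' : 0 < ((n : ℤ) + (2 + 1)) * c (n + 1) * ((c (n + 1) : ℤ) - 2 * a (n + 2)) +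
      ((n : ℤ) + (2 + 1) - ((c (n + 2) : ℤ) - c (n + 1))) * (a (n + 2) : ℤ) ^ 2 :=
    he.trans_eq (by ring)
  refine ⟨he', ?_⟩
  have hgap : (0 : ℤ) < c (n + 1) - a (n + 2) := by nlinarith
  have ha0 : (0 : ℝ) < a (n + 2) := by
    have : (0 : ℤ) < a (n + 2) := by linarith
    exact_mod_cast this
  have hgap' : (0 : ℝ) < c (n + 1) - a (n + 2) := by exact_mod_cast hgap
  have heR : (0 : ℝ) < ((n : ℝ) + (2 + 1)) * c (n + 1) * ((c (n + 1) : ℝ) - 2 * a (n + 2)) +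
      ((n : ℝ) + (2 + 1) - ((c (n + 2) : ℝ) - c (n + 1))) * (a (n + 2) : ℝ) ^ 2 := by
    exact_mod_cast he'
  rw [sub_pos, div_lt_div_iff₀ (by positivity) (by positivity)]
  linarith
end
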